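/- Let V be a finite-dimensional real inner product space, let I be a finite index set, and for each i ∈ I let fᵢ : V → ℝ be a nonzero linear functional and kᵢ ∈ ℝ, defining the closed half-space Hᵢ = {v ∈ V : fᵢ(v) ≤ kᵢ}. Suppose P = ⋂_{i ∈ I} Hᵢ is a polytope and let F be a proper face of P. Then there exists l ∈ I such that F ⊆ {v ∈ V : f_l(v) = k_l}, i.e. F is contained in the boundary hyperplane of H_l. -/

import Mathlib

open Set

variable {V : Type*} [NormedAddCommGroup V] [InnerProductSpace ℝ V] [FiniteDimensional ℝ V]

/-- `F` is a face of the convex set `C`. -/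
def IsFace (C F : Set V) : Prop :=
  F.Nonempty ∧ Convex ℝ F ∧ F ⊆ C ∧
    ∀ x ∈ C, ∀ y ∈ C, ∀ α : ℝ, 0 < α → α < 1 → α • x + (1 - α) • y ∈ F → x ∈ F ∧ y ∈ F

/-- If every half-space of a finite family contains a point of the nonempty convex set `F` in its
interior, then some point of `F` is interior to all of them. -/
theorem Convex.exists_forall_mem_lt {E I : Type*} [AddCommGroup E] [Module ℝ E]
    {F : Set E} (hF : Convex ℝ F) (hne : F.Nonempty) (f : I → (E →ₗ[ℝ] ℝ)) (k : I → ℝ)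
    (hle : ∀ i, ∀ x ∈ F, f i x ≤ k i) (hlt : ∀ i, ∃ x ∈ F, f i x < k i) (s : Finset I) :
    ∃ z ∈ F, ∀ i ∈ s, f i z < k i := by
  classical
  induction s using Finset.induction_on with
  | empty => exact hne.imp fun z hz => ⟨hz, by simp⟩
  | insert a s _ ih =>
    obtain ⟨z, hz, hzs⟩ := ih
    obtain ⟨x, hx, hxa⟩ := hlt a
    refine ⟨(1 / 2 : ℝ) • z + (1 / 2 : ℝ) • x,
      hF hz hx (by norm_num) (by norm_num) (by norm_num), fun i hi => ?_⟩
    simp only [map_add, map_smul, smul_eq_mul]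
    rcases Finset.mem_insert.1 hi with rfl | hi
    · linarith [hle i z hz]
    · linarith [hle i x hx, hzs i hi]

/-- A segment ending at a point where finitely many linear inequalities hold strictly can be
prolonged beyond that point without violating them. -/
theorem exists_pos_forall_map_add_smul_sub_lt {E I : Type*} [AddCommGroup E] [Module ℝ E]
    [Finite I] (f : I → (E →ₗ[ℝ] ℝ)) (k : I → ℝ) {z : E} (hz : ∀ i, f i z < k i) (y : E) :
    ∃ t : ℝ, 0 < t ∧ ∀ i, f i (z + t • (z - y)) < k i := by
  have h : ∀ᶠ t : ℝ in nhds 0, ∀ i, f i (z + t • (z - y)) < k i := by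
    refine Filter.eventually_all.2 fun i => ?_
    have hc : Continuous fun t : ℝ => f i (z + t • (z - y)) := by
      simp only [map_add, map_smul, smul_eq_mul]
      fun_prop
    exact hc.continuousAt.eventually_lt continuousAt_const (by simpa using hz i)
  obtain ⟨t, ht, ht0⟩ :=
    ((h.filter_mono nhdsWithin_le_nhds).and (self_mem_nhdsWithin (s := Set.Ioi (0 : ℝ)))).exists
  exact ⟨t, ht0, ht⟩

/-- If a polytope `P` is presented as a finite intersection of closed
half-spaces `Hᵢ = {v : fᵢ v ≤ kᵢ}` and `F` is a proper face of `P`, then `F` is contained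
in the boundary hyperplane of one of the half-spaces. -/
theorem proper_face_lies_in_some_boundary_hyperplane
    {I : Type*} [Fintype I] (f : I → (V →ₗ[ℝ] ℝ)) (k : I → ℝ)
    (hfne : ∀ i, f i ≠ 0)
    (P : Set V) (hP : P = ⋂ i, {v : V | f i v ≤ k i})
    (hcpt : IsCompact P) (hconv : Convex ℝ P)
    (hfin : (Set.extremePoints ℝ P).Finite)
    (F : Set V) (hF : IsFace P F) (hproper : F ≠ P) :
    ∃ l, F ⊆ {v : V | f l v = k l} := by
  subst hP
  obtain ⟨hne, hFconv, hFP, hface⟩ := hF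
  by_contra! h
  have hle : ∀ i, ∀ x ∈ F, f i x ≤ k i := fun i x hx => Set.mem_iInter.1 (hFP hx) i
  have hlt : ∀ i, ∃ x ∈ F, f i x < k i := fun i => by
    obtain ⟨x, hx, hxk⟩ := Set.not_subset.1 (h i)
    exact ⟨x, hx, (hle i x hx).lt_of_ne hxk⟩
  obtain ⟨z, hzF, hz⟩ := hFconv.exists_forall_mem_lt hne f k hle hlt Finset.univ
  refine hproper (hFP.antisymm fun y hy => ?_)
  obtain ⟨t, ht, hw⟩ :=
    exists_pos_forall_map_add_smul_sub_lt f k (fun i => hz i (Finset.mem_univ i)) y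
  refine (hface y hy (z + t • (z - y)) (Set.mem_iInter.2 fun i => (hw i).le) (t / (1 + t))
    (by positivity) ((div_lt_one (by positivity)).2 (by linarith)) ?_).1
  convert hzF using 1
  match_scalars <;> field_simp <;> ring
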